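/- arXiv:2010.13473 — 2 statements merged into one kernel-verified Lean document; each statement's English description precedes it below -/
import Mathlib

section
/- Let G be a geometric graph on ℤ² and let p, q ∈ ℤ² with |p−q| = 1. If the segment pq is not an edge of G, then d_G(p,q) ≥ 1+√2. (Indeed, any walk from p to q in G with at least two edges, whose vertices all lie in ℤ², has Euclidean length at least 1+√2.) -/
open SimpleGraph ENNReal

/-- The point of the Euclidean plane (identified with `ℂ`) corresponding to a lattice point. -/
noncomputable def toC (p : ℤ × ℤ) : ℂ := ⟨(p.1 : ℝ), (p.2 : ℝ)⟩

/-- The Euclidean length of a walk in a geometric graph on `ℤ²`: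
the sum of the Euclidean lengths of its edges. -/
noncomputable def walkLen (G : SimpleGraph (ℤ × ℤ)) :
    ∀ {p q : ℤ × ℤ}, G.Walk p q → ℝ
  | _, _, .nil => 0
  | p, _, .cons (v := v) _ w => dist (toC p) (toC v) + walkLen G w

/-- The graph distance `d_G(p,q)`: infimum of Euclidean lengths of walks from `p` to `q`
(`∞` if there is no walk). -/
noncomputable def gdist (G : SimpleGraph (ℤ × ℤ)) (p q : ℤ × ℤ) : ℝ≥0∞ :=
  ⨅ w : G.Walk p q, ENNReal.ofReal (walkLen G w)

/-- `G` has maximum degree at most `3`. -/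
def MaxDegThree (G : SimpleGraph (ℤ × ℤ)) : Prop :=
  ∀ v : ℤ × ℤ, (G.neighborSet v).encard ≤ 3

/-- `G` is plane: two distinct edges, viewed as closed segments in the plane,
intersect at most in a common endpoint. -/
def IsPlane (G : SimpleGraph (ℤ × ℤ)) : Prop :=
  ∀ a b c d : ℤ × ℤ, G.Adj a b → G.Adj c d → s(a, b) ≠ s(c, d) →
    ∀ x : ℂ, x ∈ segment ℝ (toC a) (toC b) → x ∈ segment ℝ (toC c) (toC d) →
      x ∈ ({toC a, toC b} : Set ℂ) ∧ x ∈ ({toC c, toC d} : Set ℂ)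

/-- `G` is locally optimal. -/
def LocallyOptimal (G : SimpleGraph (ℤ × ℤ)) : Prop :=
  IsPlane G ∧ MaxDegThree G ∧
    ∀ p q : ℤ × ℤ, dist (toC p) (toC q) ≤ Real.sqrt 5 →
      gdist G p q ≤ ENNReal.ofReal ((1 + Real.sqrt 2) * dist (toC p) (toC q))

/-- The dilation of `G`. -/
noncomputable def dil (G : SimpleGraph (ℤ × ℤ)) : ℝ≥0∞ :=
  ⨆ (p : ℤ × ℤ) (q : ℤ × ℤ) (_ : p ≠ q),
    gdist G p q / ENNReal.ofReal (dist (toC p) (toC q))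

lemma dist_toC (u v : ℤ × ℤ) :
    dist (toC u) (toC v) = √(((u.1 - v.1) ^ 2 + (u.2 - v.2) ^ 2 : ℤ) : ℝ) := by
  rw [Complex.dist_eq_re_im]
  simp [toC]

lemma sq_add_sq_pos {u v : ℤ × ℤ} (h : u ≠ v) :
    0 < (u.1 - v.1) ^ 2 + (u.2 - v.2) ^ 2 := by
  by_contra! hle
  have h₁ : u.1 - v.1 = 0 := by nlinarith [sq_nonneg (u.1 - v.1), sq_nonneg (u.2 - v.2)]
  have h₂ : u.2 - v.2 = 0 := by nlinarith [sq_nonneg (u.1 - v.1), sq_nonneg (u.2 - v.2)]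
  exact h (Prod.ext (by lia) (by lia))

lemma one_le_dist_toC {u v : ℤ × ℤ} (h : u ≠ v) : 1 ≤ dist (toC u) (toC v) := by
  rw [dist_toC, Real.one_le_sqrt]
  exact_mod_cast sq_add_sq_pos h

/-- If `p` and `q` are at unit distance, they have opposite parity, so the two legs of a detour
through a third lattice point cannot both have unit length. -/
lemma one_add_sqrt_two_le_dist_add_dist {p q v : ℤ × ℤ}
    (hpq : dist (toC p) (toC q) = 1) (hpv : p ≠ v) (hvq : v ≠ q) :
    1 + √2 ≤ dist (toC p) (toC v) + dist (toC v) (toC q) := by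
  have hunit : (p.1 - q.1) ^ 2 + (p.2 - q.2) ^ 2 = 1 := by
    rw [dist_toC, Real.sqrt_eq_one] at hpq
    exact_mod_cast hpq
  have sqrt_two_le {a b : ℤ × ℤ} (h : 2 ≤ (a.1 - b.1) ^ 2 + (a.2 - b.2) ^ 2) :
      √2 ≤ dist (toC a) (toC b) := by
    rw [dist_toC]
    exact Real.sqrt_le_sqrt (by exact_mod_cast h)
  have hlegs : 2 ≤ (p.1 - v.1) ^ 2 + (p.2 - v.2) ^ 2 ∨
      2 ≤ (v.1 - q.1) ^ 2 + (v.2 - q.2) ^ 2 := by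
    by_contra! h
    have h₁ : (p.1 - v.1) ^ 2 + (p.2 - v.2) ^ 2 = 1 := by have := sq_add_sq_pos hpv; lia
    have h₂ : (v.1 - q.1) ^ 2 + (v.2 - q.2) ^ 2 = 1 := by have := sq_add_sq_pos hvq; lia
    -- the squared lengths satisfy `|p - q|² = |p - v|² + |v - q|² + 2⟨p - v, v - q⟩`
    have heven : 1 = 2 * (1 + (p.1 - v.1) * (v.1 - q.1) + (p.2 - v.2) * (v.2 - q.2)) := by
      linear_combination h₁ + h₂ - hunit
    lia
  have h₁ := one_le_dist_toC hpv
  have h₂ := one_le_dist_toC hvq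
  rcases hlegs with h | h <;> linarith [sqrt_two_le h]

lemma length_le_walkLen (G : SimpleGraph (ℤ × ℤ)) {p q : ℤ × ℤ} (w : G.Walk p q) :
    (w.length : ℝ) ≤ walkLen G w := by
  induction w with
  | nil => simp [walkLen]
  | cons h w ih =>
    have := one_le_dist_toC h.ne
    simp only [Walk.length_cons, walkLen]
    push_cast
    linarith

lemma one_add_sqrt_two_le_walkLen (G : SimpleGraph (ℤ × ℤ)) {p q : ℤ × ℤ}
    (hpq : dist (toC p) (toC q) = 1) (w : G.Walk p q) (hw : 2 ≤ w.length) :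
    1 + √2 ≤ walkLen G w := by
  match w with
  | .nil | .cons _ .nil => simp at hw
  | .cons h (.cons h' .nil) =>
    simpa [walkLen] using one_add_sqrt_two_le_dist_add_dist hpq h.ne h'.ne
  | .cons h (.cons h' (.cons h'' w)) =>
    have hlen := length_le_walkLen G (.cons h (.cons h' (.cons h'' w)))
    have hsqrt : √2 ≤ 2 := Real.sqrt_le_iff.mpr (by norm_num)
    have : (0 : ℝ) ≤ w.length := Nat.cast_nonneg _
    simp only [Walk.length_cons] at hlen
    push_cast at hlen
    linarith

/-- If |p−q| = 1 and pq is not an edge of G, then d_G(p,q) ≥ 1+√2; indeed any walk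
from p to q with at least two edges has Euclidean length at least 1+√2. -/
theorem non_edge_unit_pair_dist (G : SimpleGraph (ℤ × ℤ)) (p q : ℤ × ℤ)
    (hpq : dist (toC p) (toC q) = 1) (hne : ¬ G.Adj p q) :
    ENNReal.ofReal (1 + Real.sqrt 2) ≤ gdist G p q ∧
      ∀ w : G.Walk p q, 2 ≤ w.length → 1 + Real.sqrt 2 ≤ walkLen G w := by
  refine ⟨le_iInf fun w => ENNReal.ofReal_le_ofReal (one_add_sqrt_two_le_walkLen G hpq w ?_),
    one_add_sqrt_two_le_walkLen G hpq⟩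
  match w with
  | .nil => simp at hpq
  | .cons h .nil => exact absurd h hne
  | .cons _ (.cons _ _) => simp
end

section
/- There exists a plane geometric graph G on ℤ² with maximum degree at most 3 whose dilation equals 1+√2, i.e., d_G(p,q) ≤ (1+√2)·|p−q| for all p, q ∈ ℤ², and this bound is attained for some pair of distinct points. -/
open SimpleGraph ENNReal

section Spanner

/-! ### The graph -/

/-- The class of a lattice point modulo the period lattice of the spanner. -/
def latticeClass (p : ℤ × ℤ) : Fin 8 :=
  Fin.ofNat 8 ((p.1 - 2 * p.2) % 8).toNat

theorem latticeClass_add (p q : ℤ × ℤ) :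
    latticeClass (p + q) = latticeClass p + latticeClass q := by
  apply Fin.ext
  simp only [latticeClass, Fin.val_add, Fin.val_ofNat, Prod.fst_add, Prod.snd_add]
  omega

/-- The displacements to the neighbours of a vertex, depending on its class. -/
def spannerSteps : Fin 8 → List (ℤ × ℤ) :=
  ![[(0, 1), (1, -1), (-1, 1)], [(0, 1), (1, -1), (0, -1)],
    [(1, 0), (1, -1), (0, -1)], [(-1, 1), (-1, 0), (0, 1)],
    [(-1, 1), (0, 1), (0, -1)], [(-1, 1), (1, -1), (0, -1)],
    [(0, -1), (1, 0), (0, 1)], [(0, -1), (-1, 0), (0, 1)]]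

theorem neg_mem_spannerSteps :
    ∀ c : Fin 8, ∀ d ∈ spannerSteps c, -d ∈ spannerSteps (c + latticeClass d) := by
  decide +kernel

theorem ne_zero_of_mem_spannerSteps : ∀ c : Fin 8, ∀ d ∈ spannerSteps c, d ≠ 0 := by
  decide +kernel

/-- A periodic cubic plane graph on `ℤ²` whose edges are sides and diagonals of unit squares. -/
def spanner : SimpleGraph (ℤ × ℤ) where
  Adj p q := q - p ∈ spannerSteps (latticeClass p)
  symm := ⟨fun p q h => by
    have := neg_mem_spannerSteps _ _ h
    rwa [← latticeClass_add, add_sub_cancel, neg_sub] at this⟩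
  loopless := ⟨fun p h => ne_zero_of_mem_spannerSteps _ _ h (sub_self p)⟩

theorem spanner_maxDegThree : MaxDegThree spanner := by
  intro v
  have hlen : ∀ c : Fin 8, (spannerSteps c).length ≤ 3 := by decide +kernel
  have hsub : spanner.neighborSet v ⊆
      (((spannerSteps (latticeClass v)).map (v + ·)).toFinset : Set (ℤ × ℤ)) := by
    intro q hq
    have hq' : q - v ∈ spannerSteps (latticeClass v) := hq
    simp only [List.coe_toFinset, Set.mem_ofPred_eq, List.mem_map]
    exact ⟨_, hq', by abel⟩
  refine (Set.encard_le_encard hsub).trans ?_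
  rw [Set.encard_coe_eq_coe_finsetCard]
  have h := (List.toFinset_card_le ((spannerSteps (latticeClass v)).map (v + ·))).trans
    ((List.length_map _).trans_le (hlen _))
  exact_mod_cast h

/-! ### Coordinates -/

theorem toC_add (p q : ℤ × ℤ) : toC (p + q) = toC p + toC q := by
  apply Complex.ext <;> simp [toC]

theorem toC_sub (p q : ℤ × ℤ) : toC (p - q) = toC p - toC q := by
  apply Complex.ext <;> simp [toC]

theorem norm_toC_sq (p : ℤ × ℤ) : ‖toC p‖ ^ 2 = (p.1 : ℝ) ^ 2 + (p.2 : ℝ) ^ 2 := by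
  rw [← Complex.normSq_eq_norm_sq, Complex.normSq_apply]
  simp [toC]
  ring

/-! ### Planarity -/

/-- A linear functional with coefficients `l` shows that the segments `[0, d]` and `[v, v + e]`
meet at most in a common endpoint. -/
def Separates (d v e l : ℤ × ℤ) : Prop :=
  let p := l.1 * d.1 + l.2 * d.2
  let q := l.1 * e.1 + l.2 * e.2
  let r := l.1 * v.1 + l.2 * v.2
  max p 0 + max (-q) 0 < r ∨ max p 0 + max (-q) 0 = r ∧ p ≠ 0 ∧ q ≠ 0

instance (d v e l : ℤ × ℤ) : Decidable (Separates d v e l) := by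
  unfold Separates; infer_instance

/-- The lattice points with coordinates of absolute value at most `n`. -/
def latticeBox (n : ℕ) : List (ℤ × ℤ) :=
  (List.range (2 * n + 1)).flatMap fun i : ℕ => (List.range (2 * n + 1)).map fun j : ℕ =>
    ((i : ℤ) - n, (j : ℤ) - n)

theorem mem_latticeBox {n : ℕ} {v : ℤ × ℤ} (h₁ : |v.1| ≤ n) (h₂ : |v.2| ≤ n) :
    v ∈ latticeBox n := by
  rw [abs_le] at h₁ h₂
  simp only [latticeBox, List.mem_flatMap, List.mem_map, List.mem_range]
  exact ⟨(v.1 + n).toNat, by omega, (v.2 + n).toNat, by omega, by ext <;> simp <;> omega⟩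

theorem spannerSteps_abs_le_one :
    ∀ c : Fin 8, ∀ d ∈ spannerSteps c, |d.1| ≤ 1 ∧ |d.2| ≤ 1 := by
  decide +kernel

theorem spannerSteps_separated : ∀ c : Fin 8, ∀ d ∈ spannerSteps c, ∀ v ∈ latticeBox 2,
    ∀ e ∈ spannerSteps (c + latticeClass v),
      (v = 0 ∧ e = d) ∨ (v = d ∧ e = -d) ∨ ∃ l ∈ latticeBox 2, Separates d v e l := by
  decide +kernel

theorem mul_le_max_zero {t p : ℝ} (h₀ : 0 ≤ t) (h₁ : t ≤ 1) : t * p ≤ max p 0 := by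
  rcases le_total 0 p with hp | hp
  · rw [max_eq_left hp]; nlinarith
  · rw [max_eq_right hp]; nlinarith

theorem eq_zero_or_one_of_mul_eq_max {t p : ℝ} (hp : p ≠ 0) (h : t * p = max p 0) :
    t = 0 ∨ t = 1 := by
  rcases le_total 0 p with h' | h'
  · rw [max_eq_left h'] at h
    exact Or.inr (mul_right_cancel₀ hp (by linarith))
  · rw [max_eq_right h'] at h
    exact Or.inl ((mul_eq_zero.mp h).resolve_right hp)

theorem Separates.eq_zero_or_one {d v e l : ℤ × ℤ} (h : Separates d v e l) {t u : ℝ}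
    (ht₀ : 0 ≤ t) (ht₁ : t ≤ 1) (hu₀ : 0 ≤ u) (hu₁ : u ≤ 1)
    (h₁ : t * d.1 - u * e.1 = v.1) (h₂ : t * d.2 - u * e.2 = v.2) :
    (t = 0 ∨ t = 1) ∧ (u = 0 ∨ u = 1) := by
  simp only [Separates] at h
  set p := l.1 * d.1 + l.2 * d.2 with hp
  set q := l.1 * e.1 + l.2 * e.2 with hq
  set r := l.1 * v.1 + l.2 * v.2 with hr
  have hsum : t * (p : ℝ) + u * (-q : ℝ) = r := by
    rw [hp, hq, hr]; push_cast; rw [← h₁, ← h₂]; ring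
  have hp' := mul_le_max_zero (p := (p : ℝ)) ht₀ ht₁
  have hq' := mul_le_max_zero (p := (-q : ℝ)) hu₀ hu₁
  rcases h with h | ⟨h, hp0, hq0⟩
  · have h' : max (p : ℝ) 0 + max (-q : ℝ) 0 < r := by exact_mod_cast h
    linarith
  · have h' : max (p : ℝ) 0 + max (-q : ℝ) 0 = r := by exact_mod_cast h
    exact ⟨eq_zero_or_one_of_mul_eq_max (p := (p : ℝ)) (by exact_mod_cast hp0) (by linarith),
      eq_zero_or_one_of_mul_eq_max (p := (-q : ℝ)) (by simpa using hq0) (by linarith)⟩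

theorem mem_segment_toC {a b : ℤ × ℤ} {x : ℂ} (h : x ∈ segment ℝ (toC a) (toC b)) :
    ∃ t : ℝ, 0 ≤ t ∧ t ≤ 1 ∧ x = toC a + t * toC (b - a) := by
  rw [segment_eq_image'] at h
  obtain ⟨t, ⟨h₀, h₁⟩, rfl⟩ := h
  exact ⟨t, h₀, h₁, by rw [toC_sub]; simp⟩

theorem mem_endpoints_toC {a b : ℤ × ℤ} {t : ℝ} (h : t = 0 ∨ t = 1) :
    toC a + t * toC (b - a) ∈ ({toC a, toC b} : Set ℂ) := by
  rcases h with rfl | rfl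
  · simp
  · simp [toC_sub]

theorem spanner_isPlane : IsPlane spanner := by
  intro a b c d hab hcd hne x hx hx'
  obtain ⟨t, ht₀, ht₁, hxt⟩ := mem_segment_toC hx
  obtain ⟨u, hu₀, hu₁, hxu⟩ := mem_segment_toC hx'
  have hab' : b - a ∈ spannerSteps (latticeClass a) := hab
  have hcd' : d - c ∈ spannerSteps (latticeClass c) := hcd
  have heq : toC a + t * toC (b - a) = toC c + u * toC (d - c) := hxt.symm.trans hxu
  have h₁ : t * ((b - a).1 : ℝ) - u * ((d - c).1 : ℝ) = ((c - a).1 : ℤ) := by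
    have := congrArg Complex.re heq
    simp [toC] at this ⊢
    linarith
  have h₂ : t * ((b - a).2 : ℝ) - u * ((d - c).2 : ℝ) = ((c - a).2 : ℤ) := by
    have := congrArg Complex.im heq
    simp [toC] at this ⊢
    linarith
  have hbox : ∀ {m n k : ℤ}, |m| ≤ 1 → |n| ≤ 1 → t * (m : ℝ) - u * (n : ℝ) = k →
      |k| ≤ ((2 : ℕ) : ℤ) := by
    intro m n k hm hn hk
    have hm' : |(m : ℝ)| ≤ 1 := by exact_mod_cast hm
    have hn' : |(n : ℝ)| ≤ 1 := by exact_mod_cast hn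
    have : |(k : ℝ)| ≤ 2 := by
      rw [← hk]
      refine (abs_sub _ _).trans ?_
      rw [abs_mul, abs_mul, abs_of_nonneg ht₀, abs_of_nonneg hu₀]
      nlinarith [abs_nonneg (m : ℝ), abs_nonneg (n : ℝ)]
    exact_mod_cast this
  have hd := spannerSteps_abs_le_one _ _ hab'
  have he := spannerSteps_abs_le_one _ _ hcd'
  have hv : c - a ∈ latticeBox 2 :=
    mem_latticeBox (hbox hd.1 he.1 h₁) (hbox hd.2 he.2 h₂)
  have hcd'' : d - c ∈ spannerSteps (latticeClass a + latticeClass (c - a)) := by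
    rwa [← latticeClass_add, add_sub_cancel]
  rcases spannerSteps_separated _ _ hab' _ hv _ hcd'' with ⟨h, h'⟩ | ⟨h, h'⟩ | ⟨l, -, hl⟩
  · rw [sub_eq_zero] at h
    subst h
    exact absurd (by rw [sub_left_inj.mp h']) hne
  · have hcb : c = b := sub_left_inj.mp h
    subst hcb
    have hda : d = a := by
      rw [neg_sub] at h'
      exact sub_left_inj.mp h'
    subst hda
    exact absurd Sym2.eq_swap hne
  · obtain ⟨ht, hu⟩ := hl.eq_zero_or_one ht₀ ht₁ hu₀ hu₁ h₁ h₂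
    exact ⟨hxt ▸ mem_endpoints_toC ht, hxu ▸ mem_endpoints_toC hu⟩

/-! ### Walks -/

theorem walkLen_append (G : SimpleGraph (ℤ × ℤ)) {p q r : ℤ × ℤ} (w : G.Walk p q)
    (w' : G.Walk q r) : walkLen G (w.append w') = walkLen G w + walkLen G w' := by
  induction w with
  | nil => simp [walkLen]
  | cons h w ih => simp [walkLen, ih, add_assoc]

theorem gdist_le_of_walk {G : SimpleGraph (ℤ × ℤ)} {p q : ℤ × ℤ} {x : ℝ}
    (h : ∃ w : G.Walk p q, walkLen G w ≤ x) : gdist G p q ≤ ENNReal.ofReal x := by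
  obtain ⟨w, hw⟩ := h
  exact (iInf_le _ w).trans (ENNReal.ofReal_le_ofReal hw)

theorem dist_toC_le_walkLen (G : SimpleGraph (ℤ × ℤ)) {p q : ℤ × ℤ} (w : G.Walk p q) :
    dist (toC p) (toC q) ≤ walkLen G w := by
  induction w with
  | nil => simp [walkLen]
  | cons h w ih =>
    rw [walkLen]
    exact (dist_triangle _ _ _).trans (by gcongr)

/-- Whether `test` succeeds for the displacement, the number of sides and the number of diagonals
of some extension, by at most `k` steps, of a walk with data `T`, `n`, `m` ending in class `c`. -/
def searchWalk (test : ℤ × ℤ → ℕ → ℕ → Bool) : ℕ → Fin 8 → ℤ × ℤ → ℕ → ℕ → Bool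
  | 0, _, T, n, m => test T n m
  | k + 1, c, T, n, m => test T n m || (spannerSteps c).any fun d =>
      if d.1 * d.2 = 0 then searchWalk test k (c + latticeClass d) (T + d) (n + 1) m
      else searchWalk test k (c + latticeClass d) (T + d) n (m + 1)

theorem norm_toC_spannerStep {c : Fin 8} {d : ℤ × ℤ} (h : d ∈ spannerSteps c) :
    ‖toC d‖ = if d.1 * d.2 = 0 then 1 else √2 := by
  have key : ∀ c : Fin 8, ∀ d ∈ spannerSteps c,
      d.1 ^ 2 + d.2 ^ 2 = if d.1 * d.2 = 0 then 1 else 2 := by decide +kernel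
  have h' : (d.1 : ℝ) ^ 2 + (d.2 : ℝ) ^ 2 = if d.1 * d.2 = 0 then 1 else 2 := by
    exact_mod_cast key c d h
  rw [← Real.sqrt_sq (norm_nonneg (toC d)), norm_toC_sq, h']
  split_ifs <;> simp

theorem exists_walk_of_searchWalk {test : ℤ × ℤ → ℕ → ℕ → Bool} {p : ℤ × ℤ} :
    ∀ (k : ℕ) (T : ℤ × ℤ) (n m : ℕ),
      searchWalk test k (latticeClass (p + T)) T n m = true →
      (∃ w : spanner.Walk p (p + T), walkLen spanner w = n + m * √2) →
      ∃ (T' : ℤ × ℤ) (n' m' : ℕ), test T' n' m' = true ∧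
        ∃ w : spanner.Walk p (p + T'), walkLen spanner w = n' + m' * √2 := by
  intro k
  induction k with
  | zero => exact fun T n m h hw => ⟨T, n, m, h, hw⟩
  | succ k ih =>
    intro T n m h hw
    rw [searchWalk, Bool.or_eq_true, List.any_eq_true] at h
    rcases h with h | ⟨d, hd, h⟩
    · exact ⟨T, n, m, h, hw⟩
    · obtain ⟨w, hw⟩ := hw
      have hadj : spanner.Adj (p + T) (p + (T + d)) := by
        change p + (T + d) - (p + T) ∈ _
        rwa [← add_assoc, add_sub_cancel_left]
      have hlen : walkLen spanner (w.append (.cons hadj .nil)) = n + m * √2 + ‖toC d‖ := by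
        rw [walkLen_append, hw, walkLen, walkLen, ← add_assoc p T d, toC_add _ d,
          dist_self_add_right, add_zero]
      rw [norm_toC_spannerStep hd] at hlen
      rw [← latticeClass_add, add_assoc] at h
      split_ifs at h hlen with h0
      · exact ih _ _ _ h ⟨_, hlen.trans (by push_cast; ring)⟩
      · exact ih _ _ _ h ⟨_, hlen.trans (by push_cast; ring)⟩

/-! ### Progress towards a target -/

/-- An integer criterion for a walk with displacement `T`, `n` sides and `m` diagonals to approach
the point `v` at the rate required for dilation `1 + √2`. -/
def approaches (v T : ℤ × ℤ) (n m : ℕ) : Bool :=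
  let a := (v.1 - T.1) ^ 2 + (v.2 - T.2) ^ 2
  let b := v.1 ^ 2 + v.2 ^ 2
  let g := 1000 * (2 * m - n) + max (1415 * ((n : ℤ) - m)) (1414 * ((n : ℤ) - m))
  let x := 1000000 * (b - a) - g ^ 2
  0 < n + m && n + m ≤ 6 && ((a == 0 && (n : ℤ) ^ 2 + 2 * m ^ 2 ≤ 3 * b && (n : ℤ) * m ≤ b) ||
    (0 ≤ x && 4000000 * g ^ 2 * a ≤ x ^ 2))

theorem approaches_small : ∀ c : Fin 8, ∀ v ∈ latticeBox 4, v ≠ 0 →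
    ∃ k ∈ [3, 4, 5], searchWalk (approaches v) k c 0 0 0 = true := by
  decide +kernel

/-- Pairs of an axis direction and an adjacent diagonal direction. -/
def octants : List ((ℤ × ℤ) × (ℤ × ℤ)) :=
  [((1, 0), (1, 1)), ((1, 0), (1, -1)), ((-1, 0), (-1, 1)), ((-1, 0), (-1, -1)),
    ((0, 1), (1, 1)), ((0, 1), (-1, 1)), ((0, -1), (1, -1)), ((0, -1), (-1, -1))]

theorem approaches_octants : ∀ c : Fin 8, ∀ o ∈ octants,
    searchWalk (fun T n m => approaches (5 • o.1) T n m && approaches (5 • o.2) T n m)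
      5 c 0 0 0 = true := by
  decide +kernel

theorem sub_norm_le_of_approaches {v T : ℤ × ℤ} {n m : ℕ} (h : approaches v T n m = true) :
    ‖toC v - toC T‖ + (n + m * √2) * (√2 - 1) ≤ ‖toC v‖ := by
  simp only [approaches, Bool.and_eq_true, Bool.or_eq_true, decide_eq_true_eq, beq_iff_eq] at h
  have hs : √2 ^ 2 = 2 := Real.sq_sqrt zero_le_two
  have hA : ‖toC v - toC T‖ ^ 2 = ((v.1 - T.1) ^ 2 + (v.2 - T.2) ^ 2 : ℤ) := by
    rw [← toC_sub, norm_toC_sq]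
    push_cast [Prod.fst_sub, Prod.snd_sub]
    rfl
  have hB : ‖toC v‖ ^ 2 = (v.1 ^ 2 + v.2 ^ 2 : ℤ) := by
    rw [norm_toC_sq]
    push_cast
    rfl
  generalize (v.1 - T.1) ^ 2 + (v.2 - T.2) ^ 2 = a at h hA
  generalize v.1 ^ 2 + v.2 ^ 2 = b at h hB
  have hx := norm_nonneg (toC v - toC T)
  have hy := norm_nonneg (toC v)
  generalize ‖toC v - toC T‖ = x at *
  generalize ‖toC v‖ = y at *
  have hs1 : 1 < √2 := by nlinarith [Real.sqrt_nonneg 2]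
  obtain ⟨-, ⟨⟨ha, h₁⟩, h₂⟩ | ⟨h₁, h₂⟩⟩ := h
  · subst ha
    have hx0 : x = 0 := by simpa using hA
    have h₁' : (n : ℝ) ^ 2 + 2 * m ^ 2 ≤ 3 * b := by exact_mod_cast h₁
    have h₂' : (n : ℝ) * m ≤ b := by exact_mod_cast h₂
    have key : n + m * √2 ≤ (1 + √2) * y := by
      refine le_of_sq_le_sq ?_ (by positivity)
      have e₁ : (n + m * √2) ^ 2 = n ^ 2 + 2 * (m : ℝ) ^ 2 + 2 * √2 * (n * m) := by
        linear_combination (m : ℝ) ^ 2 * hs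
      have e₂ : ((1 + √2) * y) ^ 2 = 3 * b + 2 * √2 * b := by
        rw [← hB]
        linear_combination y ^ 2 * hs
      rw [e₁, e₂]
      gcongr
    rw [hx0, zero_add]
    calc _ ≤ (1 + √2) * y * (√2 - 1) := by gcongr
      _ = y := by linear_combination y * hs
  · set g : ℤ := 1000 * (2 * m - n) + max (1415 * ((n : ℤ) - m)) (1414 * ((n : ℤ) - m)) with hg
    have hg' : 1000 * ((n + m * √2) * (√2 - 1)) ≤ (g : ℝ) := by
      have l₁ : (1.414 : ℝ) ≤ √2 := Real.le_sqrt_of_sq_le (by norm_num)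
      have l₂ : √2 ≤ (1.415 : ℝ) := Real.sqrt_le_iff.mpr (by norm_num)
      have e : 1000 * ((n + m * √2) * (√2 - 1)) =
          1000 * (2 * (m : ℝ) - n) + 1000 * √2 * (n - m) := by
        linear_combination 1000 * (m : ℝ) * hs
      rw [e, hg]
      push_cast
      gcongr
      rcases le_total (m : ℝ) n with h | h
      · exact le_max_of_le_left (by nlinarith)
      · exact le_max_of_le_right (by nlinarith)
    have h₁' : 0 ≤ 1000000 * ((b : ℝ) - a) - (g : ℝ) ^ 2 := by exact_mod_cast h₁
    have h₂' : 4000000 * (g : ℝ) ^ 2 * a ≤ (1000000 * ((b : ℝ) - a) - (g : ℝ) ^ 2) ^ 2 := by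
      exact_mod_cast h₂
    have h₃ : 2000 * g * x ≤ 1000000 * ((b : ℝ) - a) - (g : ℝ) ^ 2 := by
      refine le_of_sq_le_sq (le_trans (le_of_eq ?_) h₂') h₁'
      rw [← hA]
      ring
    have h₄ : 1000 * x + g ≤ 1000 * y := by
      refine le_of_sq_le_sq ?_ (by positivity)
      rw [mul_pow 1000 y, hB]
      linear_combination h₃ + 1000000 * hA
    linarith

theorem length_bounds_of_approaches {v T : ℤ × ℤ} {n m : ℕ} (h : approaches v T n m = true) :
    0 < n + m ∧ n + m ≤ 6 := by
  simp only [approaches, Bool.and_eq_true, decide_eq_true_eq] at h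
  exact h.1

/-- The region `‖v - T‖ + r ≤ ‖v‖` bounded by a branch of a hyperbola is stable under combinations
with nonnegative coefficients of sum at least one. -/
theorem norm_sub_add_le_of_combination {E : Type*} [NormedAddCommGroup E] [InnerProductSpace ℝ E]
    {w₁ w₂ T : E} {r s t : ℝ} (hr : 0 ≤ r) (hs : 0 ≤ s) (ht : 0 ≤ t) (hst : 1 ≤ s + t)
    (h₁ : ‖w₁ - T‖ + r ≤ ‖w₁‖) (h₂ : ‖w₂ - T‖ + r ≤ ‖w₂‖) (hv : r ≤ ‖s • w₁ + t • w₂‖) :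
    ‖s • w₁ + t • w₂ - T‖ + r ≤ ‖s • w₁ + t • w₂‖ := by
  have key : ∀ w : E, ‖w - T‖ + r ≤ ‖w‖ →
      2 * r * ‖w‖ + (‖T‖ ^ 2 - r ^ 2) ≤ 2 * inner ℝ w T := by
    intro w hw
    have h := norm_sub_sq_real w T
    nlinarith [norm_nonneg (w - T)]
  have hrT : r ≤ ‖T‖ := by
    have := norm_sub_norm_le w₁ (w₁ - T)
    rw [_root_.sub_sub_cancel] at this
    linarith
  have hnorm : ‖s • w₁ + t • w₂‖ ≤ s * ‖w₁‖ + t * ‖w₂‖ := by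
    refine (norm_add_le _ _).trans (le_of_eq ?_)
    rw [norm_smul, norm_smul, Real.norm_of_nonneg hs, Real.norm_of_nonneg ht]
  have hinner : inner ℝ (s • w₁ + t • w₂) T = s * inner ℝ w₁ T + t * inner ℝ w₂ T := by
    rw [inner_add_left, real_inner_smul_left, real_inner_smul_left]
  have hsq := norm_sub_sq_real (s • w₁ + t • w₂) T
  have k₁ := mul_le_mul_of_nonneg_left (key w₁ h₁) hs
  have k₂ := mul_le_mul_of_nonneg_left (key w₂ h₂) ht
  have k₃ : 0 ≤ (s + t - 1) * (‖T‖ ^ 2 - r ^ 2) :=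
    mul_nonneg (by linarith) (by nlinarith)
  have k₄ := mul_le_mul_of_nonneg_left hnorm hr
  rw [hinner] at hsq
  refine le_sub_iff_add_le.mp (le_of_sq_le_sq ?_ (by linarith))
  linarith

theorem exists_octant (v : ℤ × ℤ) : ∃ o ∈ octants, ∃ s t : ℤ, 0 ≤ s ∧ 0 ≤ t ∧
    s + t = max |v.1| |v.2| ∧ v = s • o.1 + t • o.2 := by
  obtain ⟨x, y⟩ := v
  rcases le_total |y| |x| with h | h <;> rcases abs_cases x with ⟨hx, hx'⟩ | ⟨hx, hx'⟩ <;>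
    rcases abs_cases y with ⟨hy, hy'⟩ | ⟨hy, hy'⟩
  · exact ⟨((1, 0), (1, 1)), by simp [octants], |x| - |y|, |y|, by simp; omega⟩
  · exact ⟨((1, 0), (1, -1)), by simp [octants], |x| - |y|, |y|, by simp; omega⟩
  · exact ⟨((-1, 0), (-1, 1)), by simp [octants], |x| - |y|, |y|, by simp; omega⟩
  · exact ⟨((-1, 0), (-1, -1)), by simp [octants], |x| - |y|, |y|, by simp; omega⟩
  · exact ⟨((0, 1), (1, 1)), by simp [octants], |y| - |x|, |x|, by simp; omega⟩
  · exact ⟨((0, -1), (1, -1)), by simp [octants], |y| - |x|, |x|, by simp; omega⟩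
  · exact ⟨((0, 1), (-1, 1)), by simp [octants], |y| - |x|, |x|, by simp; omega⟩
  · exact ⟨((0, -1), (-1, -1)), by simp [octants], |y| - |x|, |x|, by simp; omega⟩

theorem exists_walk_approaching {p q : ℤ × ℤ} (hpq : p ≠ q) :
    ∃ (p' : ℤ × ℤ) (w : spanner.Walk p p'), 0 < walkLen spanner w ∧
      dist (toC p') (toC q) + walkLen spanner w * (√2 - 1) ≤ dist (toC p) (toC q) := by
  have hs : √2 ^ 2 = 2 := Real.sq_sqrt zero_le_two
  have hs1 : 1 < √2 := by nlinarith [Real.sqrt_nonneg 2]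
  set v := q - p with hv
  have hv0 : v ≠ 0 := sub_ne_zero.mpr hpq.symm
  suffices h : ∃ (T : ℤ × ℤ) (n m : ℕ), 0 < n + m ∧
      ‖toC v - toC T‖ + (n + m * √2) * (√2 - 1) ≤ ‖toC v‖ ∧
      ∃ w : spanner.Walk p (p + T), walkLen spanner w = n + m * √2 by
    obtain ⟨T, n, m, hnm, h, w, hw⟩ := h
    refine ⟨p + T, w, ?_, ?_⟩
    · rw [hw]
      rcases Nat.eq_zero_or_pos n with h0 | h0
      · have : 0 < m := by omega
        positivity
      · positivity
    · rw [hw, _root_.dist_comm, _root_.dist_comm (toC p), dist_eq_norm, dist_eq_norm, ← toC_sub q p, toC_add,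
        ← sub_sub, ← toC_sub q p]
      exact h
  have hnil : ∃ w : spanner.Walk p (p + 0), walkLen spanner w = (0 : ℕ) + (0 : ℕ) * √2 := by
    rw [add_zero]
    exact ⟨.nil, by simp [walkLen]⟩
  by_cases hbox : |v.1| ≤ (4 : ℕ) ∧ |v.2| ≤ (4 : ℕ)
  · obtain ⟨k, -, hk⟩ := approaches_small (latticeClass (p + 0)) v
      (mem_latticeBox hbox.1 hbox.2) hv0
    obtain ⟨T, n, m, h, hw⟩ := exists_walk_of_searchWalk _ _ _ _ hk hnil
    exact ⟨T, n, m, (length_bounds_of_approaches h).1, sub_norm_le_of_approaches h, hw⟩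
  · obtain ⟨o, ho, s, t, hs0, ht0, hst, hvo⟩ := exists_octant v
    obtain ⟨T, n, m, h, hw⟩ := exists_walk_of_searchWalk _ _ _ _
      (approaches_octants (latticeClass (p + 0)) o ho) hnil
    rw [Bool.and_eq_true] at h
    obtain ⟨hnm, hnm'⟩ := length_bounds_of_approaches h.1
    have h₁ := sub_norm_le_of_approaches h.1
    have h₂ := sub_norm_le_of_approaches h.2
    have hmax : 5 ≤ max |v.1| |v.2| := by
      rw [le_max_iff]
      by_contra! hlt
      exact hbox ⟨by push_cast; omega, by push_cast; omega⟩
    have hveq : toC v = ((s : ℝ) / 5) • toC (5 • o.1) + ((t : ℝ) / 5) • toC (5 • o.2) := by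
      rw [hvo]
      apply Complex.ext <;> simp [toC] <;> ring
    have hv5 : 5 ≤ ‖toC v‖ := by
      have h5 : (5 : ℝ) ≤ max |(v.1 : ℝ)| |(v.2 : ℝ)| := by exact_mod_cast hmax
      exact h5.trans (max_le (Complex.abs_re_le_norm (toC v)) (Complex.abs_im_le_norm (toC v)))
    have hcast : (n : ℝ) + m ≤ 6 := by exact_mod_cast hnm'
    have hs2 : √2 ≤ 3 / 2 := Real.sqrt_le_iff.mpr (by norm_num)
    have hr : (n + m * √2) * (√2 - 1) ≤ 5 := by
      have : n + m * √2 ≤ 9 := by nlinarith [(n.cast_nonneg : (0 : ℝ) ≤ n)]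
      nlinarith
    refine ⟨T, n, m, hnm, ?_, hw⟩
    rw [hveq] at hv5 ⊢
    refine norm_sub_add_le_of_combination (mul_nonneg (by positivity) (by linarith))
      (by positivity) (by positivity) ?_ h₁ h₂ (hr.trans hv5)
    have : (5 : ℝ) ≤ s + t := by exact_mod_cast hst ▸ hmax
    linarith

theorem spanner_exists_short_walk (p q : ℤ × ℤ) :
    ∃ w : spanner.Walk p q, walkLen spanner w ≤ (1 + √2) * dist (toC p) (toC q) := by
  have hs : √2 ^ 2 = 2 := Real.sq_sqrt zero_le_two
  have hs1 : 1 < √2 := by nlinarith [Real.sqrt_nonneg 2]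
  have hdist : ∀ p : ℤ × ℤ, dist (toC p) (toC q) ^ 2 =
      (((q.1 - p.1) ^ 2 + (q.2 - p.2) ^ 2).toNat : ℝ) := by
    intro p
    rw [_root_.dist_comm, dist_eq_norm, ← toC_sub, norm_toC_sq, ← Int.cast_natCast,
      Int.toNat_of_nonneg (by positivity)]
    push_cast [Prod.fst_sub, Prod.snd_sub]
    rfl
  induction hN : ((q.1 - p.1) ^ 2 + (q.2 - p.2) ^ 2).toNat using Nat.strong_induction_on
    generalizing p with
  | _ N ih =>
    rcases eq_or_ne p q with rfl | hpq
    · exact ⟨.nil, by simp [walkLen]⟩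
    · obtain ⟨p', w, hw, h⟩ := exists_walk_approaching hpq
      have hlt : dist (toC p') (toC q) < dist (toC p) (toC q) := by nlinarith
      have hlt' := pow_lt_pow_left₀ hlt dist_nonneg two_ne_zero
      rw [hdist, hdist, Nat.cast_lt, hN] at hlt'
      obtain ⟨w', hw'⟩ := ih _ hlt' p' rfl
      refine ⟨w.append w', ?_⟩
      rw [walkLen_append]
      have := mul_le_mul_of_nonneg_left h (by positivity : 0 ≤ 1 + √2)
      nlinarith

/-! ### Sharpness -/

theorem one_add_sqrt_two_le_dist_add_dist_s2 {v : ℤ × ℤ} (h₀ : v ≠ (0, 0)) (h₁ : v ≠ (1, 0)) :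
    1 + √2 ≤ dist (toC (0, 0)) (toC v) + dist (toC v) (toC (1, 0)) := by
  have hs2 : √2 ≤ 3 / 2 := Real.sqrt_le_iff.mpr (by norm_num)
  rw [_root_.dist_comm, dist_eq_norm, dist_eq_norm, ← toC_sub, ← toC_sub]
  obtain ⟨x, y⟩ := v
  have n₁ := norm_toC_sq ((x, y) - (0, 0))
  have n₂ := norm_toC_sq ((x, y) - (1, 0))
  have p₁ := norm_nonneg (toC ((x, y) - (0, 0)))
  have p₂ := norm_nonneg (toC ((x, y) - (1, 0)))
  generalize ‖toC ((x, y) - (0, 0))‖ = a at *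
  generalize ‖toC ((x, y) - (1, 0))‖ = b at *
  simp only [Prod.mk_sub_mk, sub_zero] at n₁ n₂
  push_cast at n₁ n₂
  have hle : ∀ {r : ℝ} {z k : ℤ}, r ^ 2 = (z : ℝ) → k ≤ z → (k : ℝ) ≤ r ^ 2 :=
    fun h hk => h ▸ by exact_mod_cast hk
  have n₁' : a ^ 2 = (x ^ 2 + y ^ 2 : ℤ) := by rw [n₁]; push_cast; rfl
  have n₂' : b ^ 2 = ((x - 1) ^ 2 + y ^ 2 : ℤ) := by rw [n₂]; push_cast; rfl
  simp only [ne_eq, Prod.mk.injEq, not_and] at h₀ h₁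
  rcases eq_or_ne y 0 with rfl | hy
  · have hx : x ≤ -1 ∨ 2 ≤ x := by omega
    rcases hx with hx | hx
    · have i₁ := hle n₁' (show 1 ≤ _ by nlinarith)
      have i₂ := hle n₂' (show 4 ≤ _ by nlinarith)
      push_cast at i₁ i₂
      have : 1 ≤ a := by nlinarith
      have : 2 ≤ b := by nlinarith
      linarith
    · have i₁ := hle n₁' (show 4 ≤ _ by nlinarith)
      have i₂ := hle n₂' (show 1 ≤ _ by nlinarith)
      push_cast at i₁ i₂
      have : 2 ≤ a := by nlinarith
      have : 1 ≤ b := by nlinarith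
      linarith
  · have hy' : 1 ≤ y ^ 2 := Int.add_one_le_iff.mpr (sq_pos_iff.mpr hy)
    rcases le_or_gt x 0 with hx | hx
    · have i₁ := hle n₁' (show 1 ≤ _ by nlinarith)
      have i₂ := hle n₂' (show 2 ≤ _ by nlinarith)
      push_cast at i₁ i₂
      have := Real.sqrt_le_iff.mpr ⟨p₂, i₂⟩
      nlinarith
    · have i₁ := hle n₁' (show 2 ≤ _ by nlinarith)
      have i₂ := hle n₂' (show 1 ≤ _ by nlinarith)
      push_cast at i₁ i₂
      have := Real.sqrt_le_iff.mpr ⟨p₁, i₁⟩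
      nlinarith

theorem spanner_walkLen_ge (w : spanner.Walk (0, 0) (1, 0)) : 1 + √2 ≤ walkLen spanner w := by
  cases w with
  | @cons _ v _ h w =>
    rw [walkLen]
    refine (one_add_sqrt_two_le_dist_add_dist_s2 h.ne' ?_).trans
      (add_le_add_right (dist_toC_le_walkLen _ w) _)
    rintro rfl
    have h' : ((1, 0) - (0, 0) : ℤ × ℤ) ∈ spannerSteps (latticeClass (0, 0)) := h
    revert h'
    decide +kernel

end Spanner

/-- There is a plane geometric graph on ℤ² of maximum degree at most 3 with dilation
exactly 1+√2: the bound d_G(p,q) ≤ (1+√2)|p−q| holds for all pairs and is attained. -/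
theorem exists_optimal_degree_three_spanner :
    ∃ G : SimpleGraph (ℤ × ℤ), IsPlane G ∧ MaxDegThree G ∧
      (∀ p q : ℤ × ℤ,
        gdist G p q ≤ ENNReal.ofReal ((1 + Real.sqrt 2) * dist (toC p) (toC q))) ∧
      ∃ p q : ℤ × ℤ, p ≠ q ∧
        gdist G p q = ENNReal.ofReal ((1 + Real.sqrt 2) * dist (toC p) (toC q)) := by
  refine ⟨spanner, spanner_isPlane, spanner_maxDegThree,
    fun p q => gdist_le_of_walk (spanner_exists_short_walk p q), (0, 0), (1, 0), by decide, ?_⟩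
  have hdist : dist (toC (0, 0)) (toC (1, 0)) = 1 := by
    rw [_root_.dist_comm, dist_eq_norm, ← toC_sub, ← Real.sqrt_sq (norm_nonneg _), norm_toC_sq]
    simp
  refine le_antisymm (gdist_le_of_walk (spanner_exists_short_walk _ _)) (le_iInf fun w => ?_)
  rw [hdist, mul_one]
  exact ENNReal.ofReal_le_ofReal (spanner_walkLen_ge w)
end
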